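/- arXiv:2108.13248 — 2 statements merged into one kernel-verified Lean document; each statement's English description precedes it below -/
import Mathlib

section
/- For every γ ∈ (0,2) and C₀ > 0 there exists C₁ > 0 with the following property. Let L ≤ N be positive integers and let f : {1,…,L} → [0,∞) satisfy Σ_{r=1}^{s} r·f(r) ≤ C₀·s²·f(s) for all integers 1 ≤ s ≤ L. Define θ(r) = f(min{L,r})·(min{L,r}/min{N,r})^{γ} for integers r ≥ 1. Then Σ_{r=1}^{s} r·θ(r) ≤ C₁·s²·θ(s) for all integers 1 ≤ s ≤ 2N. -/
theorem aux_key (a C u : ℝ) (ha : 0 < a) (hC : 1 + 1 / a ≤ C) (hu : 0 < u) (hu1 : u ≤ 1) :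
    C * u ^ a + (1 - u) ≤ C := by
  have hia : 0 < 1 / a := by positivity
  rcases le_total a 1 with h | h
  · have h1 : (1 + (u - 1)) ^ a ≤ 1 + a * (u - 1) :=
      rpow_one_add_le_one_add_mul_self (by linarith) ha.le h
    rw [show 1 + (u - 1) = u by ring] at h1
    have h2 : 1 ≤ C * a := by
      have := mul_le_mul_of_nonneg_right hC ha.le
      have h3 : (1 + 1 / a) * a = a + 1 := by field_simp
      linarith
    have h4 : C * u ^ a ≤ C * (1 + a * (u - 1)) := mul_le_mul_of_nonneg_left h1 (by linarith)
    nlinarith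
  · have h1 : u ^ a ≤ u ^ (1 : ℝ) := Real.rpow_le_rpow_of_exponent_ge hu hu1 h
    rw [Real.rpow_one] at h1
    nlinarith

theorem aux_step (γ C s l : ℝ) (hγ2 : γ < 2) (hC : 1 + 1 / (2 - γ) ≤ C) (hs : 0 < s)
    (hl : 0 < l) : C * s ^ 2 * (l / s) ^ γ + (s + 1) * (l / (s + 1)) ^ γ
      ≤ C * (s + 1) ^ 2 * (l / (s + 1)) ^ γ := by
  have hs1 : 0 < s + 1 := by linarith
  have k := aux_key (2 - γ) C (s / (s + 1)) (by linarith) hC (by positivity)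
    (by rw [div_le_one hs1]; linarith)
  rw [Real.rpow_sub (by positivity), Real.rpow_two, Real.div_rpow hs.le hs1.le γ] at k
  rw [Real.div_rpow hl.le hs.le, Real.div_rpow hl.le hs1.le]
  have e1 : 0 < s ^ γ := by positivity
  have e2 : 0 < (s + 1) ^ γ := by positivity
  have e3 : 0 < l ^ γ := by positivity
  have k2 := mul_le_mul_of_nonneg_left k
    (show 0 ≤ (s + 1) ^ 2 * (l ^ γ / (s + 1) ^ γ) by positivity)
  refine le_trans (le_of_eq ?_) (k2.trans (le_of_eq ?_))
  · field_simp
    ring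
  · ring


/-- **Summation bound for the truncated-arm-type weight `θ`.**
For every `γ ∈ (0,2)` and `C₀ > 0` there is a `C₁ > 0` such that: whenever `1 ≤ L ≤ N` are
integers and `f : {1,…,L} → [0,∞)` satisfies `Σ_{r=1}^s r f(r) ≤ C₀ s² f(s)` for all
`1 ≤ s ≤ L`, the function `θ(r) = f(min{L,r}) (min{L,r}/min{N,r})^γ` satisfies
`Σ_{r=1}^s r θ(r) ≤ C₁ s² θ(s)` for all `1 ≤ s ≤ 2N`. -/
theorem theta_sum_bound (γ C₀ : ℝ) (hγ0 : 0 < γ) (hγ2 : γ < 2) (hC₀ : 0 < C₀) :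
    ∃ C₁ : ℝ, 0 < C₁ ∧
      ∀ (L N : ℕ), 1 ≤ L → L ≤ N →
        ∀ f : ℕ → ℝ, (∀ r, 0 ≤ f r) →
          (∀ s : ℕ, 1 ≤ s → s ≤ L →
            ∑ r ∈ Finset.Icc 1 s, (r : ℝ) * f r ≤ C₀ * (s : ℝ) ^ 2 * f s) →
          ∀ s : ℕ, 1 ≤ s → s ≤ 2 * N →
            (∑ r ∈ Finset.Icc 1 s,
                (r : ℝ) * (f (min L r) * (((min L r : ℕ) : ℝ) / ((min N r : ℕ) : ℝ)) ^ γ))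
              ≤ C₁ * (s : ℝ) ^ 2 *
                (f (min L s) * (((min L s : ℕ) : ℝ) / ((min N s : ℕ) : ℝ)) ^ γ) := by
  have ha : 0 < 2 - γ := by linarith
  have hia : 0 < 1 / (2 - γ) := by positivity
  refine ⟨C₀ + (1 + 1 / (2 - γ)), by linarith, ?_⟩
  intro L N hL hLN f hf h s hs _
  set C := C₀ + (1 + 1 / (2 - γ)) with hCdef
  have hC : 1 + 1 / (2 - γ) ≤ C := by linarith
  have base : ∀ s : ℕ, 1 ≤ s → s ≤ L → (∑ r ∈ Finset.Icc 1 s,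
                (r : ℝ) * (f (min L r) * (((min L r : ℕ) : ℝ) / ((min N r : ℕ) : ℝ)) ^ γ))
              ≤ C * (s : ℝ) ^ 2 *
                (f (min L s) * (((min L s : ℕ) : ℝ) / ((min N s : ℕ) : ℝ)) ^ γ) := by
    intro s hs hsL
    have e : ∀ r : ℕ, 1 ≤ r → r ≤ L →
        f (min L r) * (((min L r : ℕ) : ℝ) / ((min N r : ℕ) : ℝ)) ^ γ = f r := by
      intro r h1 h2
      have hr : (r : ℝ) ≠ 0 := by positivity
      rw [min_eq_right h2, min_eq_right (h2.trans hLN), div_self hr, Real.one_rpow, mul_one]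
    rw [e s hs hsL]
    have : ∑ r ∈ Finset.Icc 1 s,
        (r : ℝ) * (f (min L r) * (((min L r : ℕ) : ℝ) / ((min N r : ℕ) : ℝ)) ^ γ)
        = ∑ r ∈ Finset.Icc 1 s, (r : ℝ) * f r := by
      refine Finset.sum_congr rfl fun r hr => ?_
      rw [Finset.mem_Icc] at hr
      rw [e r hr.1 (hr.2.trans hsL)]
    rw [this]
    refine (h s hs hsL).trans ?_
    have := hf s
    gcongr
    linarith
  rcases le_total s L with hsL | hsL
  · exact base s hs hsL
  clear hs
  induction s, hsL using Nat.le_induction with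
  | base => exact base L hL le_rfl
  | succ s hsL ih =>
    have ih := ih (by omega)
    rw [Finset.sum_Icc_succ_top (by omega)]
    refine (add_le_add_left ih _).trans ?_
    have hs0 : (0 : ℝ) < s := by exact_mod_cast (by omega : 0 < s)
    have hl0 : (0 : ℝ) < L := by exact_mod_cast (by omega : 0 < L)
    rw [min_eq_left hsL, min_eq_left (by omega : L ≤ s + 1)]
    have hfL := hf L
    rcases Nat.lt_or_ge s N with hsN | hsN
    · rw [min_eq_right hsN.le, min_eq_right (by omega : s + 1 ≤ N)]
      push_cast
      have k := mul_le_mul_of_nonneg_left (aux_step γ C s L hγ2 hC hs0 hl0) hfL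
      linarith
    · rw [min_eq_left hsN, min_eq_left (by omega : N ≤ s + 1)]
      push_cast
      have hT : 0 ≤ f L * ((L : ℝ) / (N : ℝ)) ^ γ := by positivity
      have k : C * (s : ℝ) ^ 2 + (s + 1) ≤ C * ((s : ℝ) + 1) ^ 2 := by nlinarith
      have := mul_le_mul_of_nonneg_right k hT
      linarith
end

section
/- Let X be a nonnegative random variable, and let C > 0, β ∈ (0,1), and K ≥ 1 be real numbers. Suppose that 𝔼[X^k] ≤ (C·k^{β}·K^{1−β})^k for all real k with 1 ≤ k ≤ K, and 𝔼[X^k] ≤ (C·k)^k for all real k ≥ K. Then for every λ with C·e·K^{1−β} ≤ λ ≤ C·e·K one has ℙ(X ≥ λ) ≤ exp(−(λ/(C·e·K^{1−β}))^{1/β}), and for every λ ≥ C·e·K one has ℙ(X ≥ λ) ≤ exp(−λ/(C·e)). -/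
open MeasureTheory Real

theorem tail_aux {Ω : Type*} [MeasurableSpace Ω] (P : Measure Ω)
    (X : Ω → ℝ) (hXmeas : Measurable X) (k M : ℝ) (hk : 0 < k) (hM : 0 < M)
    (h : ∫⁻ ω, ENNReal.ofReal (X ω ^ k) ∂P ≤ ENNReal.ofReal (M ^ k)) :
    P {ω | Real.exp 1 * M ≤ X ω} ≤ ENNReal.ofReal (Real.exp (-k)) := by
  have hl : 0 < Real.exp 1 * M := by positivity
  have hpow : (Real.exp 1 * M) ^ k = Real.exp k * M ^ k := by
    rw [Real.mul_rpow (Real.exp_pos 1).le hM.le, Real.exp_one_rpow]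
  have hlk : 0 < (Real.exp 1 * M) ^ k := Real.rpow_pos_of_pos hl k
  have hsub : {ω | Real.exp 1 * M ≤ X ω} ⊆
      {ω | ENNReal.ofReal ((Real.exp 1 * M) ^ k) ≤ ENNReal.ofReal (X ω ^ k)} := by
    intro ω hω
    exact ENNReal.ofReal_le_ofReal (Real.rpow_le_rpow hl.le hω hk.le)
  have hmk := meas_ge_le_lintegral_div (μ := P)
    (f := fun ω => ENNReal.ofReal (X ω ^ k)) (by fun_prop)
    (ε := ENNReal.ofReal ((Real.exp 1 * M) ^ k))
    (by simpa using hlk) ENNReal.ofReal_ne_top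
  refine (measure_mono hsub).trans (hmk.trans ?_)
  refine (ENNReal.div_le_div_right h _).trans ?_
  rw [← ENNReal.ofReal_div_of_pos hlk]
  apply ENNReal.ofReal_le_ofReal
  have hMk : 0 < M ^ k := Real.rpow_pos_of_pos hM k
  rw [hpow, Real.exp_neg]
  apply le_of_eq
  field_simp

/-- **Tail bound from stretched moment bounds.**
If a nonnegative random variable `X` satisfies `𝔼[X^k] ≤ (C k^β K^{1-β})^k` for all real
`1 ≤ k ≤ K` and `𝔼[X^k] ≤ (C k)^k` for all real `k ≥ K`, then
`ℙ(X ≥ λ) ≤ exp(−(λ/(C e K^{1−β}))^{1/β})` for `C e K^{1−β} ≤ λ ≤ C e K`, and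
`ℙ(X ≥ λ) ≤ exp(−λ/(C e))` for `λ ≥ C e K`. -/
theorem tail_bound_from_moments
    {Ω : Type*} [MeasurableSpace Ω] (P : Measure Ω) [IsProbabilityMeasure P]
    (X : Ω → ℝ) (hXmeas : Measurable X) (hXnonneg : ∀ ω, 0 ≤ X ω)
    (C β K : ℝ) (hC : 0 < C) (hβ0 : 0 < β) (hβ1 : β < 1) (hK : 1 ≤ K)
    (hmom₁ : ∀ k : ℝ, 1 ≤ k → k ≤ K →
      ∫⁻ ω, ENNReal.ofReal (X ω ^ k) ∂P ≤ ENNReal.ofReal ((C * k ^ β * K ^ (1 - β)) ^ k))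
    (hmom₂ : ∀ k : ℝ, K ≤ k →
      ∫⁻ ω, ENNReal.ofReal (X ω ^ k) ∂P ≤ ENNReal.ofReal ((C * k) ^ k)) :
    (∀ lam : ℝ, C * Real.exp 1 * K ^ (1 - β) ≤ lam → lam ≤ C * Real.exp 1 * K →
      P {ω | lam ≤ X ω} ≤
        ENNReal.ofReal (Real.exp (-(lam / (C * Real.exp 1 * K ^ (1 - β))) ^ (1 / β)))) ∧
    (∀ lam : ℝ, C * Real.exp 1 * K ≤ lam →
      P {ω | lam ≤ X ω} ≤ ENNReal.ofReal (Real.exp (-(lam / (C * Real.exp 1))))) := by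
  have he := Real.exp_pos 1
  have hK0 : 0 < K := by linarith
  have hKb : 0 < K ^ (1 - β) := Real.rpow_pos_of_pos hK0 _
  constructor
  · intro lam h1 h2
    have hD : 0 < C * Real.exp 1 * K ^ (1 - β) := by positivity
    set r := lam / (C * Real.exp 1 * K ^ (1 - β)) with hr
    have hr1 : 1 ≤ r := (one_le_div hD).2 h1
    have hr0 : 0 ≤ r := by linarith
    have hlam : lam = r * (C * Real.exp 1 * K ^ (1 - β)) := by
      rw [hr]; field_simp
    have hkβ : (r ^ (1 / β)) ^ β = r := by
      rw [← Real.rpow_mul hr0, one_div_mul_cancel hβ0.ne', Real.rpow_one]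
    have hk1 : 1 ≤ r ^ (1 / β) := Real.one_le_rpow hr1 (by positivity)
    have hKK : K ^ β * K ^ (1 - β) = K := by
      rw [← Real.rpow_add hK0]; simp
    have hrK : r ≤ K ^ β := by
      rw [hr, div_le_iff₀ hD]
      calc lam ≤ C * Real.exp 1 * K := h2
        _ = C * Real.exp 1 * (K ^ β * K ^ (1 - β)) := by rw [hKK]
        _ = _ := by ring
    have hkK : r ^ (1 / β) ≤ K := by
      calc r ^ (1 / β) ≤ (K ^ β) ^ (1 / β) := Real.rpow_le_rpow hr0 hrK (by positivity)
        _ = K := by rw [← Real.rpow_mul hK0.le, mul_one_div_cancel hβ0.ne', Real.rpow_one]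
    have hm := hmom₁ _ hk1 hkK
    rw [hkβ] at hm
    have := tail_aux P X hXmeas _ _ (by linarith) (by positivity) hm
    convert this using 5
    rw [hlam]; ring
  · intro lam h1
    have hD : 0 < C * Real.exp 1 := by positivity
    have hkK : K ≤ lam / (C * Real.exp 1) := by
      rw [le_div_iff₀ hD]; linarith
    have hk0 : 0 < lam / (C * Real.exp 1) := by linarith
    have := tail_aux P X hXmeas _ _ hk0 (mul_pos hC hk0) (hmom₂ _ hkK)
    convert this using 5
    field_simp
end
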